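/- Fix an integer k ≥ 2. Let |𝒞_n| be the number of vertices of the one-in-core of the random k-out digraph 𝒟_{n,k}. Then (|𝒞_n| − ν_k n)/(σ_k √n) converges in distribution to a standard normal random variable as n → ∞; that is, for every x ∈ ℝ, P((|𝒞_n| − ν_k n)/(σ_k √n) ≤ x) → (1/√(2π)) ∫_{−∞}^x e^{−t²/2} dt. -/

import Mathlib

open scoped Classical
open Filter MeasureTheory

/-- Probability of an event under the uniform random `k`-out digraph model `𝒟_{n,k}`:
a uniformly random function `f : [n] × [k] → [n]`. -/
noncomputable def prob (n k : ℕ) (P : (Fin n × Fin k → Fin n) → Prop) : ℝ :=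
  ((Finset.univ.filter P).card : ℝ) / (Fintype.card (Fin n × Fin k → Fin n) : ℝ)

/-- One arc step: there is a labeled arc from `u` to `v`. -/
def Step {n k : ℕ} (f : Fin n × Fin k → Fin n) (u v : Fin n) : Prop :=
  ∃ i : Fin k, f (u, i) = v

/-- `u` reaches `v` by following finitely many arcs. -/
def Reaches {n k : ℕ} (f : Fin n × Fin k → Fin n) : Fin n → Fin n → Prop :=
  Relation.ReflTransGen (Step f)

/-- A set of vertices is closed if no arc leaves it. -/
def IsClosedSet {n k : ℕ} (f : Fin n × Fin k → Fin n) (S : Set (Fin n)) : Prop :=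
  ∀ v ∈ S, ∀ i : Fin k, f (v, i) ∈ S

/-- A set of vertices is strongly connected if it is nonempty and
any two of its vertices reach each other. -/
def IsStrConn {n k : ℕ} (f : Fin n × Fin k → Fin n) (S : Set (Fin n)) : Prop :=
  S.Nonempty ∧ ∀ u ∈ S, ∀ v ∈ S, Reaches f u v

/-- `G` is the giant: a closed strongly connected set of maximum size,
ties broken by choosing the one containing the smallest vertex label. -/
def IsGiant {n k : ℕ} (f : Fin n × Fin k → Fin n) (G : Set (Fin n)) : Prop :=
  IsClosedSet f G ∧ IsStrConn f G ∧
    (∀ S : Set (Fin n), IsClosedSet f S → IsStrConn f S → S.ncard ≤ G.ncard) ∧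
    (∀ S : Set (Fin n), IsClosedSet f S → IsStrConn f S → S.ncard = G.ncard →
      ∃ v ∈ G, ∀ u ∈ S, v ≤ u)

/-- The one-in-core: the largest (equivalently, the union of all) sets `S`
in which every vertex has an in-neighbor inside `S`. -/
def oneCore {n k : ℕ} (f : Fin n × Fin k → Fin n) : Set (Fin n) :=
  ⋃₀ {S : Set (Fin n) | ∀ v ∈ S, ∃ u ∈ S, ∃ i : Fin k, f (u, i) = v}

section Peeling

variable {n k : ℕ}

/-- The set of heads of the arcs whose tails lie in `P`. -/
noncomputable def outImage (f : Fin n × Fin k → Fin n) (P : Finset (Fin n)) : Finset (Fin n) :=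
  (P ×ˢ Finset.univ).image f

theorem mem_outImage {f : Fin n × Fin k → Fin n} {P : Finset (Fin n)} {v : Fin n} :
    v ∈ outImage f P ↔ ∃ u ∈ P, ∃ i, f (u, i) = v := by
  simp only [outImage, Finset.mem_image, Finset.mem_product, Finset.mem_univ, and_true,
    Prod.exists]
  constructor
  · rintro ⟨u, i, hu, h⟩
    exact ⟨u, hu, i, h⟩
  · rintro ⟨u, hu, i, h⟩
    exact ⟨u, i, hu, h⟩

theorem outImage_mono (f : Fin n × Fin k → Fin n) {P Q : Finset (Fin n)} (h : P ⊆ Q) :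
    outImage f P ⊆ outImage f Q :=
  Finset.image_subset_image (Finset.product_subset_product_left h)

/-- A chosen element of `P`, outside `B` whenever possible. -/
noncomputable def pick [NeZero n] (P B : Finset (Fin n)) : Fin n :=
  if h : (P \ B).Nonempty then h.choose else if h : P.Nonempty then h.choose else 0

theorem pick_mem [NeZero n] {P : Finset (Fin n)} (hP : P.Nonempty) (B : Finset (Fin n)) :
    pick P B ∈ P := by
  unfold pick
  split_ifs with h
  · exact (Finset.mem_sdiff.1 h.choose_spec).1
  · exact hP.choose_spec

theorem pick_notMem [NeZero n] {P B : Finset (Fin n)} (h : ¬ P ⊆ B) : pick P B ∉ B := by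
  have h' : (P \ B).Nonempty := Finset.sdiff_nonempty.2 h
  unfold pick
  rw [dif_pos h']
  exact (Finset.mem_sdiff.1 h'.choose_spec).2

/-- The vertices that remain after peeling `m` vertices, peeling vertices without
in-neighbors among the remaining ones first. -/
noncomputable def remaining [NeZero n] (f : Fin n × Fin k → Fin n) : ℕ → Finset (Fin n)
  | 0 => Finset.univ
  | m + 1 => (remaining f m).erase (pick (remaining f m) (outImage f (remaining f m)))

/-- The `m`-th vertex to be peeled. -/
noncomputable def peeled [NeZero n] (f : Fin n × Fin k → Fin n) (m : ℕ) : Fin n :=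
  pick (remaining f m) (outImage f (remaining f m))

/-- The arcs listed in peeling order of their tails. -/
noncomputable def peelSort [NeZero n] (f : Fin n × Fin k → Fin n) : Fin n × Fin k → Fin n :=
  fun p => f (peeled f p.1, p.2)

/-- The index set of the rows from `m` on. -/
def rowsFrom (n k m : ℕ) : Finset (Fin n × Fin k) :=
  Finset.univ.filter fun p => m ≤ (p.1 : ℕ)

theorem mem_rowsFrom {m : ℕ} {p : Fin n × Fin k} : p ∈ rowsFrom n k m ↔ m ≤ (p.1 : ℕ) := by
  simp [rowsFrom]

theorem rowsFrom_anti {m m' : ℕ} (h : m ≤ m') : rowsFrom n k m' ⊆ rowsFrom n k m := fun _ hp =>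
  mem_rowsFrom.2 (h.trans (mem_rowsFrom.1 hp))

theorem card_rowsFrom (n k m : ℕ) : (rowsFrom n k m).card = (n - m) * k := by
  have h : rowsFrom n k m = (Finset.univ.filter fun a : Fin n => m ≤ (a : ℕ)) ×ˢ Finset.univ := by
    ext p
    simp [mem_rowsFrom]
  have h2 : (Finset.univ.filter fun a : Fin n => m ≤ (a : ℕ)).card = n - m := by
    have h3 := Finset.card_filter_add_card_filter_not (s := (Finset.univ : Finset (Fin n)))
      (fun a : Fin n => m ≤ (a : ℕ))
    have h4 : (Finset.univ.filter fun a : Fin n => ¬ m ≤ (a : ℕ)).card = min n m := by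
      simp only [not_le]
      exact Fin.card_filter_val_lt
    rw [h4, Finset.card_univ, Fintype.card_fin] at h3
    omega
  rw [h, Finset.card_product, h2, Finset.card_univ, Fintype.card_fin]

theorem subset_oneCore {f : Fin n × Fin k → Fin n} {S : Finset (Fin n)} (h : S ⊆ outImage f S) :
    (S : Set (Fin n)) ⊆ oneCore f := by
  apply Set.subset_sUnion_of_mem
  intro v hv
  exact mem_outImage.1 (h hv)

theorem exists_pred_of_mem_oneCore {f : Fin n × Fin k → Fin n} {v : Fin n} (hv : v ∈ oneCore f) :
    ∃ u ∈ oneCore f, ∃ i, f (u, i) = v := by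
  obtain ⟨S, hS, hvS⟩ := hv
  obtain ⟨u, hu, i, h⟩ := hS v hvS
  exact ⟨u, ⟨S, hS, hu⟩, i, h⟩

variable [NeZero n]

theorem card_remaining (f : Fin n × Fin k → Fin n) {m : ℕ} (hm : m ≤ n) :
    (remaining f m).card = n - m := by
  induction m with
  | zero => simp [remaining]
  | succ m ih =>
    have h := ih (by omega)
    rw [remaining, Finset.card_erase_of_mem, h]
    · omega
    · exact pick_mem (Finset.card_pos.1 (by omega)) _

theorem peeled_mem (f : Fin n × Fin k → Fin n) {m : ℕ} (hm : m < n) :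
    peeled f m ∈ remaining f m :=
  pick_mem (Finset.card_pos.1 (by rw [card_remaining f hm.le]; omega)) _

theorem remaining_eq_image (f : Fin n × Fin k → Fin n) {m : ℕ} (hm : m ≤ n) :
    remaining f m = (Finset.univ.filter fun a : Fin n => m ≤ (a : ℕ)).image
      (fun a : Fin n => peeled f a) := by
  induction hm using Nat.decreasingInduction with
  | self =>
    have h : remaining f n = ∅ := Finset.card_eq_zero.1 (by rw [card_remaining f le_rfl]; omega)
    rw [h]
    symm
    simp only [Finset.image_eq_empty, Finset.filter_eq_empty_iff]
    intro a _
    have := a.2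
    omega
  | of_succ m hm ih =>
    have h : remaining f m = insert (peeled f m) (remaining f (m + 1)) := by
      rw [remaining, ← peeled, Finset.insert_erase (peeled_mem f hm)]
    rw [h, ih]
    have h2 : (Finset.univ.filter fun a : Fin n => m ≤ (a : ℕ)) =
        insert ⟨m, hm⟩ (Finset.univ.filter fun a : Fin n => m + 1 ≤ (a : ℕ)) := by
      ext a
      simp only [Finset.mem_filter, Finset.mem_univ, true_and, Finset.mem_insert, Fin.ext_iff]
      omega
    rw [h2, Finset.image_insert]

theorem outImage_remaining (f : Fin n × Fin k → Fin n) {m : ℕ} (hm : m ≤ n) :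
    outImage f (remaining f m) = (rowsFrom n k m).image (peelSort f) := by
  ext v
  rw [mem_outImage, remaining_eq_image f hm]
  simp only [Finset.mem_image, Finset.mem_filter, Finset.mem_univ, true_and, mem_rowsFrom,
    peelSort, Prod.exists]
  constructor
  · rintro ⟨u, ⟨a, ha, rfl⟩, i, h⟩
    exact ⟨a, i, ha, h⟩
  · rintro ⟨a, i, ha, h⟩
    exact ⟨_, ⟨a, ha, rfl⟩, i, h⟩

theorem peelSort_injective :
    Function.Injective (peelSort : (Fin n × Fin k → Fin n) → (Fin n × Fin k → Fin n)) := by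
  intro f f' h
  have hrem : ∀ m ≤ n, remaining f m = remaining f' m := by
    intro m
    induction m with
    | zero => intro _; rfl
    | succ m ih =>
      intro hm
      have h1 := ih (by omega)
      have h2 : outImage f (remaining f m) = outImage f' (remaining f' m) := by
        rw [outImage_remaining f (by omega), outImage_remaining f' (by omega), h]
      rw [remaining, remaining, h2, h1]
  have hpeel : ∀ a : Fin n, peeled f a = peeled f' a := by
    intro a
    have h1 := hrem a a.2.le
    have h2 : outImage f (remaining f a) = outImage f' (remaining f' a) := by
      rw [outImage_remaining f a.2.le, outImage_remaining f' a.2.le, h]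
    rw [peeled, peeled, h2, h1]
  funext ⟨v, i⟩
  have hv : v ∈ remaining f 0 := Finset.mem_univ v
  rw [remaining_eq_image f (Nat.zero_le n)] at hv
  obtain ⟨a, -, rfl⟩ := Finset.mem_image.1 hv
  have h3 := congrFun h (a, i)
  simp only [peelSort] at h3
  rw [h3, hpeel]

theorem oneCore_subset_remaining {f : Fin n × Fin k → Fin n} {m : ℕ}
    (h : ∀ l < m, ¬ remaining f l ⊆ outImage f (remaining f l)) :
    oneCore f ⊆ remaining f m ∧ outImage f (remaining f m) ⊆ remaining f m := by
  induction m with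
  | zero => exact ⟨fun v _ => Finset.mem_coe.2 (Finset.mem_univ v), Finset.subset_univ _⟩
  | succ m ih =>
    obtain ⟨h1, h2⟩ := ih fun l hl => h l (by omega)
    have hp := pick_notMem (h m (by omega))
    have hsub : remaining f (m + 1) ⊆ remaining f m := Finset.erase_subset _ _
    constructor
    · intro v hv
      rw [Finset.mem_coe, remaining, Finset.mem_erase]
      refine ⟨?_, h1 hv⟩
      rintro rfl
      obtain ⟨u, hu, i, hui⟩ := exists_pred_of_mem_oneCore hv
      exact hp (mem_outImage.2 ⟨u, h1 hu, i, hui⟩)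
    · intro v hv
      have hv' := outImage_mono f hsub hv
      rw [remaining, Finset.mem_erase]
      refine ⟨?_, h2 hv'⟩
      rintro rfl
      exact hp hv'

theorem le_ncard_oneCore_iff (f : Fin n × Fin k → Fin n) {s : ℕ} :
    s ≤ (oneCore f).ncard ↔
      ∃ m ≤ n, s ≤ n - m ∧ n - m ≤ ((rowsFrom n k m).image (peelSort f)).card := by
  have hex : ∃ m, remaining f m ⊆ outImage f (remaining f m) := by
    refine ⟨n, ?_⟩
    rw [Finset.card_eq_zero.1 (by rw [card_remaining f le_rfl]; omega : (remaining f n).card = 0)]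
    exact Finset.empty_subset _
  have hle : Nat.find hex ≤ n := by
    refine Nat.find_min' hex ?_
    rw [Finset.card_eq_zero.1 (by rw [card_remaining f le_rfl]; omega : (remaining f n).card = 0)]
    exact Finset.empty_subset _
  have hcore : oneCore f = remaining f (Nat.find hex) :=
    Set.Subset.antisymm (oneCore_subset_remaining fun l hl => Nat.find_min hex hl).1
      (subset_oneCore (Nat.find_spec hex))
  rw [hcore, Set.ncard_coe_finset, card_remaining f hle]
  constructor
  · intro hs
    refine ⟨Nat.find hex, hle, hs, ?_⟩
    rw [← outImage_remaining f hle, ← card_remaining f hle]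
    exact Finset.card_le_card (Nat.find_spec hex)
  · rintro ⟨m, hm, hs, hc⟩
    have : Nat.find hex ≤ m := by
      by_contra hlt
      push Not at hlt
      have hsub := (oneCore_subset_remaining (m := m)
        fun l hl => Nat.find_min hex (hl.trans hlt)).2
      rw [← outImage_remaining f hm, ← card_remaining f hm] at hc
      have := Finset.eq_of_subset_of_card_le hsub hc
      exact Nat.find_min hex hlt this.ge
    omega

theorem prob_oneCore_eq (s : ℕ) :
    prob n k (fun f => s ≤ (oneCore f).ncard) =
      prob n k fun g => ∃ m ≤ n, s ≤ n - m ∧ n - m ≤ ((rowsFrom n k m).image g).card := by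
  unfold prob
  congr 2
  have hbij : Function.Bijective
      (peelSort : (Fin n × Fin k → Fin n) → (Fin n × Fin k → Fin n)) :=
    Finite.injective_iff_bijective.1 peelSort_injective
  refine Finset.card_bijective _ hbij fun f => ?_
  simp only [Finset.mem_filter, Finset.mem_univ, true_and]
  exact le_ncard_oneCore_iff f

end Peeling

section Averages

variable {ι V : Type*} [DecidableEq ι]

theorem image_update_of_notMem [DecidableEq V] {J : Finset ι} {i : ι} (hi : i ∉ J) (g : ι → V) (v : V) :
    J.image (Function.update g i v) = J.image g := by
  refine Finset.image_congr fun j hj => ?_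
  have : j ≠ i := by
    rintro rfl
    exact hi hj
  simp [Function.update_of_ne this]

variable [Fintype ι] [Fintype V]

/-- The expectation of `F` under the uniform distribution on `ι → V`. -/
noncomputable def avg (F : (ι → V) → ℝ) : ℝ :=
  (∑ g, F g) / (Fintype.card (ι → V) : ℝ)

theorem avg_mono {F G : (ι → V) → ℝ} (h : ∀ g, F g ≤ G g) : avg F ≤ avg G := by
  unfold avg
  gcongr
  exact h _

theorem avg_add (F G : (ι → V) → ℝ) : avg (fun g => F g + G g) = avg F + avg G := by
  simp only [avg, Finset.sum_add_distrib, add_div]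

theorem avg_const_mul (c : ℝ) (F : (ι → V) → ℝ) : avg (fun g => c * F g) = c * avg F := by
  simp only [avg, ← Finset.mul_sum, mul_div_assoc]

theorem avg_sum {κ : Type*} (s : Finset κ) (F : κ → (ι → V) → ℝ) :
    avg (fun g => ∑ r ∈ s, F r g) = ∑ r ∈ s, avg (F r) := by
  unfold avg
  rw [Finset.sum_comm, Finset.sum_div]

theorem avg_const [Nonempty V] (c : ℝ) : avg (fun _ : ι → V => c) = c := by
  have : (Fintype.card (ι → V) : ℝ) ≠ 0 := Nat.cast_ne_zero.2 Fintype.card_ne_zero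
  simp only [avg, Finset.sum_const, Finset.card_univ, nsmul_eq_mul]
  field_simp

/-- Resampling one coordinate does not change the expectation. -/
theorem avg_resample [Nonempty V] (i : ι) (F : (ι → V) → ℝ) :
    avg F = avg fun g => (∑ v, F (Function.update g i v)) / (Fintype.card V : ℝ) := by
  have hV : (Fintype.card V : ℝ) ≠ 0 := Nat.cast_ne_zero.2 Fintype.card_ne_zero
  have hinv : Function.Involutive
      (fun p : (ι → V) × V => (Function.update p.1 i p.2, p.1 i)) := by
    rintro ⟨g, v⟩
    simp
  have h : ∑ p : (ι → V) × V, F (Function.update p.1 i p.2) = ∑ p : (ι → V) × V, F p.1 :=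
    Equiv.sum_comp hinv.toPerm fun p : (ι → V) × V => F p.1
  rw [Fintype.sum_prod_type, Fintype.sum_prod_type] at h
  simp only [Finset.sum_const, Finset.card_univ, nsmul_eq_mul] at h
  rw [← Finset.mul_sum] at h
  unfold avg
  rw [← Finset.sum_div, h]
  field_simp

end Averages

/-- The distribution function of the waiting time until `d` distinct coupons
out of `n` have been collected. -/
noncomputable def waitCdf (n : ℕ) : ℕ → ℕ → ℝ
  | 0, _ => 1
  | _ + 1, 0 => 0
  | d + 1, j + 1 => (1 - (d : ℝ) / n) * waitCdf n d j + (d : ℝ) / n * waitCdf n (d + 1) j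

/-- A superset of `B` with exactly `c` elements, if there is one. -/
noncomputable def enlarge {n : ℕ} (c : ℕ) (B : Finset (Fin n)) : Finset (Fin n) :=
  if h : ∃ U, B ⊆ U ∧ U.card = c then h.choose else ∅

theorem enlarge_spec {n c : ℕ} {B : Finset (Fin n)} (h : B.card ≤ c) (hc : c ≤ n) :
    B ⊆ enlarge c B ∧ (enlarge c B).card = c := by
  have h' : ∃ U, B ⊆ U ∧ U.card = c :=
    Finset.exists_superset_card_eq h (by simpa using hc)
  unfold enlarge
  rw [dif_pos h']
  exact h'.choose_spec

section Occupancy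

variable {ι : Type*} [Fintype ι] [DecidableEq ι] {n : ℕ} [NeZero n]

theorem sum_indicator_card_insert (B : Finset (Fin n)) (d : ℕ) :
    (∑ v, if d + 1 ≤ (insert v B).card then (1 : ℝ) else 0) / n =
      (1 - (d : ℝ) / n) * (if d ≤ B.card then 1 else 0) +
        (d : ℝ) / n * (if d + 1 ≤ B.card then 1 else 0) := by
  have hn : (n : ℝ) ≠ 0 := Nat.cast_ne_zero.2 (NeZero.ne n)
  rcases lt_trichotomy B.card d with h | h | h
  · have h1 : ∀ v, ¬ d + 1 ≤ (insert v B).card := fun v => by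
      have := Finset.card_insert_le v B
      omega
    simp [h1, h.not_ge, h.le.not_gt]
  · have h1 : ∀ v, d + 1 ≤ (insert v B).card ↔ v ∈ Bᶜ := fun v => by
      rw [Finset.mem_compl, Finset.card_insert_eq_ite]
      split_ifs with hv <;> simp [hv, h]
    simp only [h1]
    rw [Finset.sum_ite_mem, Finset.univ_inter, Finset.sum_const, Finset.card_compl, h,
      Fintype.card_fin, nsmul_eq_mul, Nat.cast_sub (by
        rw [← h]; simpa using Finset.card_le_univ B)]
    simp
    field_simp
  · have h1 : ∀ v, d + 1 ≤ (insert v B).card := fun v =>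
      le_trans h (Finset.card_le_card (Finset.subset_insert v B))
    simp [h1, h.le, Nat.succ_le_iff.2 h, hn]

/-- The probability that the coordinates in `J` take at least `d` distinct values. -/
theorem avg_le_card_image (J : Finset ι) (d : ℕ) :
    avg (fun g : ι → Fin n => if d ≤ (J.image g).card then (1 : ℝ) else 0) =
      waitCdf n d J.card := by
  induction J using Finset.induction_on generalizing d with
  | empty =>
    cases d with
    | zero => simp [waitCdf, avg_const]
    | succ d => simp [waitCdf, avg_const]
  | insert i J hi ih =>
    cases d with
    | zero => simp [waitCdf, avg_const]
    | succ d =>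
      rw [avg_resample i, Finset.card_insert_of_notMem hi, waitCdf, ← ih, ← ih, ← avg_const_mul,
        ← avg_const_mul, ← avg_add]
      congr 1
      funext g
      simp only [Finset.image_insert, Function.update_self, image_update_of_notMem hi,
        Fintype.card_fin]
      exact sum_indicator_card_insert _ d

theorem avg_exponential {J I : Finset ι} (hIJ : Disjoint J I) {c : ℕ} (hc : c ≤ n) (z : ℝ) :
    avg (fun g : ι → Fin n => if (J.image g).card ≤ c then
      z ^ (I.filter fun i => g i ∉ enlarge c (J.image g)).card else 0) =
    (1 + (1 - (c : ℝ) / n) * (z - 1)) ^ I.card *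
      avg (fun g : ι → Fin n => if (J.image g).card ≤ c then (1 : ℝ) else 0) := by
  have hn : (n : ℝ) ≠ 0 := Nat.cast_ne_zero.2 (NeZero.ne n)
  induction I using Finset.induction_on with
  | empty => simp
  | insert i I hi ih =>
    rw [Finset.disjoint_insert_right] at hIJ
    rw [avg_resample i, Finset.card_insert_of_notMem hi, pow_succ', mul_assoc, ← ih hIJ.2,
      ← avg_const_mul]
    congr 1
    funext g
    simp only [image_update_of_notMem hIJ.1, Fintype.card_fin]
    split_ifs with h
    · set U := enlarge c (J.image g) with hU
      have hcard : U.card = c := (enlarge_spec h hc).2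
      have hterm : ∀ v, z ^ ((insert i I).filter fun j => Function.update g i v j ∉ U).card =
          (if v ∈ U then 1 else z) * z ^ (I.filter fun j => g j ∉ U).card := by
        intro v
        have hI : (I.filter fun j => Function.update g i v j ∉ U) =
            I.filter fun j => g j ∉ U := by
          refine Finset.filter_congr fun j hj => ?_
          have : j ≠ i := by
            rintro rfl
            exact hi hj
          rw [Function.update_of_ne this]
        rw [Finset.filter_insert, hI, Function.update_self]
        by_cases hv : v ∈ U
        · simp [hv]
        · simp only [hv, not_false_eq_true, if_true, if_false]
          rw [Finset.card_insert_of_notMem (by simp [hi]), pow_succ']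
      simp only [hterm]
      rw [← Finset.sum_mul, Finset.sum_ite, Finset.sum_const, Finset.sum_const]
      have h1 : (Finset.univ.filter fun v => v ∈ U).card = c := by
        rw [Finset.filter_univ_mem, hcard]
      have h2 : (Finset.univ.filter fun v => v ∉ U).card = n - c := by
        have : (Finset.univ.filter fun v => v ∉ U) = Uᶜ := by
          ext v
          simp
        rw [this, Finset.card_compl, hcard, Fintype.card_fin]
      rw [h1, h2, nsmul_eq_mul, nsmul_eq_mul, Nat.cast_sub hc]
      field_simp
      ring
    · simp

theorem avg_overshoot_le {J I : Finset ι} (hIJ : Disjoint J I) {c : ℕ} (hc : c ≤ n) {z : ℝ}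
    (hz : 1 ≤ z) (l : ℕ) :
    z ^ l * avg (fun g : ι → Fin n =>
      if (J.image g).card ≤ c ∧ c + l ≤ ((J ∪ I).image g).card then (1 : ℝ) else 0) ≤
    (1 + (1 - (c : ℝ) / n) * (z - 1)) ^ I.card := by
  have hcn : (c : ℝ) / n ≤ 1 := div_le_one_of_le₀ (by exact_mod_cast hc) (Nat.cast_nonneg n)
  have hβ : 0 ≤ 1 + (1 - (c : ℝ) / n) * (z - 1) := by
    have := mul_nonneg (sub_nonneg.2 hcn) (sub_nonneg.2 hz)
    linarith
  calc _ ≤ avg (fun g : ι → Fin n => if (J.image g).card ≤ c then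
            z ^ (I.filter fun i => g i ∉ enlarge c (J.image g)).card else 0) := by
        rw [← avg_const_mul]
        refine avg_mono fun g => ?_
        split_ifs with h1 h2 h2
        · rw [mul_one]
          refine pow_le_pow_right₀ hz ?_
          have hsub : (J ∪ I).image g ⊆ enlarge c (J.image g) ∪
              (I.filter fun i => g i ∉ enlarge c (J.image g)).image g := by
            intro v hv
            obtain ⟨i, hi, rfl⟩ := Finset.mem_image.1 hv
            rw [Finset.mem_union]
            by_cases hm : g i ∈ enlarge c (J.image g)
            · exact Or.inl hm
            · right
              rcases Finset.mem_union.1 hi with hJ | hI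
              · exact absurd ((enlarge_spec h2 hc).1 (Finset.mem_image_of_mem g hJ)) hm
              · exact Finset.mem_image_of_mem g (Finset.mem_filter.2 ⟨hI, hm⟩)
          have h3 := Finset.card_le_card hsub
          have h4 := Finset.card_union_le (enlarge c (J.image g))
            ((I.filter fun i => g i ∉ enlarge c (J.image g)).image g)
          have h5 := Finset.card_image_le (f := g)
            (s := I.filter fun i => g i ∉ enlarge c (J.image g))
          have h6 := (enlarge_spec h2 hc).2
          omega
        · exact absurd h1.1 h2
        · rw [mul_zero]
          positivity
        · rw [mul_zero]
    _ = _ := avg_exponential hIJ hc z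
    _ ≤ (1 + (1 - (c : ℝ) / n) * (z - 1)) ^ I.card * 1 := by
        refine mul_le_mul_of_nonneg_left ?_ (pow_nonneg hβ _)
        calc _ ≤ avg (fun _ : ι → Fin n => (1 : ℝ)) := avg_mono fun g => by split_ifs <;> norm_num
          _ = 1 := avg_const 1
    _ = _ := mul_one _

end Occupancy

theorem prob_eq_avg (n k : ℕ) (P : (Fin n × Fin k → Fin n) → Prop) :
    prob n k P = avg fun f => if P f then (1 : ℝ) else 0 := by
  unfold prob avg
  rw [Finset.sum_boole]

section CoreSize

variable {n k : ℕ} [NeZero n]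

theorem waitCdf_le_prob_oneCore {s : ℕ} (hs : s ≤ n) :
    waitCdf n s (s * k) ≤ prob n k fun f => s ≤ (oneCore f).ncard := by
  have hcard : (rowsFrom n k (n - s)).card = s * k := by
    rw [card_rowsFrom, Nat.sub_sub_self hs]
  rw [prob_oneCore_eq, prob_eq_avg, ← hcard, ← avg_le_card_image]
  refine avg_mono fun g => ?_
  split_ifs with h1 h2 h2
  · exact le_rfl
  · refine absurd ⟨n - s, Nat.sub_le _ _, ?_, ?_⟩ h2 <;> omega
  · exact zero_le_one
  · exact le_rfl

theorem prob_oneCore_le_waitCdf {s a : ℕ} (hs : s ≤ n) (ha : a ≤ s) {z ρ : ℝ} (hz : 1 ≤ z)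
    (hρ : 0 ≤ ρ) (hρ1 : ρ < 1)
    (h : (1 + (1 - ((s - a : ℕ) : ℝ) / n) * (z - 1)) ^ k ≤ ρ * z) :
    (prob n k fun f => s ≤ (oneCore f).ncard) ≤
      waitCdf n (s - a + 1) (s * k) + (z ^ a)⁻¹ * (1 - ρ)⁻¹ := by
  have hz0 : 0 < z := by linarith
  have hcard : (rowsFrom n k (n - s)).card = s * k := by
    rw [card_rowsFrom, Nat.sub_sub_self hs]
  set c := s - a with hc
  set J := rowsFrom n k (n - s) with hJ
  have hcn : (c : ℝ) / n ≤ 1 :=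
    div_le_one_of_le₀ (by exact_mod_cast (by omega : c ≤ n)) (Nat.cast_nonneg n)
  have hβ : 0 ≤ 1 + (1 - (c : ℝ) / n) * (z - 1) := by
    have := mul_nonneg (sub_nonneg.2 hcn) (sub_nonneg.2 hz)
    linarith
  let E : ℕ → (Fin n × Fin k → Fin n) → ℝ := fun r g =>
    if (J.image g).card ≤ c ∧ s + r ≤ ((rowsFrom n k (n - (s + r))).image g).card then 1 else 0
  have hE0 : ∀ r g, 0 ≤ E r g := fun r g => by
    simp only [E]
    split_ifs <;> norm_num
  have hE : ∀ r ∈ Finset.range (n - s + 1), avg (E r) ≤ (z ^ a)⁻¹ * ρ ^ r := by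
    intro r hr
    rw [Finset.mem_range] at hr
    set K := rowsFrom n k (n - (s + r)) with hK
    have hsub : J ⊆ K := rowsFrom_anti (by omega)
    have hI : (K \ J).card = k * r := by
      rw [Finset.card_sdiff_of_subset hsub, hcard, hK, card_rowsFrom,
        Nat.sub_sub_self (by omega), add_mul, Nat.add_sub_cancel_left, mul_comm]
    have h1 := avg_overshoot_le (Finset.disjoint_sdiff (s := J) (t := K)) (c := c) (n := n)
      (by omega) hz (r + a)
    rw [Finset.union_sdiff_of_subset hsub, hI, (by omega : c + (r + a) = s + r), pow_mul,
      pow_add] at h1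
    have h2 : z ^ r * z ^ a * avg (E r) ≤ (ρ * z) ^ r :=
      h1.trans (pow_le_pow_left₀ (pow_nonneg hβ _) h r)
    rw [mul_pow, mul_comm (ρ ^ r), mul_assoc] at h2
    have h3 := le_of_mul_le_mul_left h2 (pow_pos hz0 r)
    rw [inv_mul_eq_div, le_div_iff₀ (pow_pos hz0 a), mul_comm]
    exact h3
  rw [prob_oneCore_eq, prob_eq_avg]
  calc _ ≤ avg (fun g : Fin n × Fin k → Fin n =>
          (if c + 1 ≤ (J.image g).card then (1 : ℝ) else 0) +
            ∑ r ∈ Finset.range (n - s + 1), E r g) := by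
        refine avg_mono fun g => ?_
        have hsum0 : 0 ≤ ∑ r ∈ Finset.range (n - s + 1), E r g :=
          Finset.sum_nonneg fun r _ => hE0 r g
        split_ifs with h1 h2 h2
        · linarith
        · obtain ⟨m, hm, hsm, hmc⟩ := h1
          have h3 : E (n - m - s) g = 1 := by
            simp only [E]
            rw [if_pos]
            refine ⟨by omega, ?_⟩
            rw [(by omega : s + (n - m - s) = n - m), (by omega : n - (n - m) = m)]
            exact hmc
          rw [zero_add, ← h3]
          exact Finset.single_le_sum (f := fun r => E r g) (fun r _ => hE0 r g)
            (Finset.mem_range.2 (by omega))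
        · linarith
        · linarith
    _ = waitCdf n (c + 1) (s * k) + ∑ r ∈ Finset.range (n - s + 1), avg (E r) := by
        rw [avg_add, avg_le_card_image, hcard, avg_sum]
    _ ≤ waitCdf n (c + 1) (s * k) + ∑ r ∈ Finset.range (n - s + 1), (z ^ a)⁻¹ * ρ ^ r := by
        gcongr with r hr
        exact hE r hr
    _ ≤ _ := by
        rw [← Finset.mul_sum]
        gcongr
        rw [← tsum_geometric_of_lt_one hρ hρ1]
        exact (summable_geometric_of_lt_one hρ hρ1).sum_le_tsum _ fun r _ => pow_nonneg hρ r

end CoreSize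

section WaitingTime

variable {n : ℕ}

theorem waitCdf_nonneg {d : ℕ} (hd : d ≤ n) (j : ℕ) : 0 ≤ waitCdf n d j := by
  induction j generalizing d with
  | zero => cases d <;> simp [waitCdf]
  | succ j ih =>
    cases d with
    | zero => simp [waitCdf]
    | succ d =>
      have h1 : (d : ℝ) / n ≤ 1 :=
        div_le_one_of_le₀ (by exact_mod_cast (by omega : d ≤ n)) (Nat.cast_nonneg n)
      have h2 : (0 : ℝ) ≤ (d : ℝ) / n := by positivity
      rw [waitCdf]
      exact add_nonneg (mul_nonneg (sub_nonneg.2 h1) (ih (by omega))) (mul_nonneg h2 (ih hd))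

theorem waitCdf_le_succ {d : ℕ} (hd : d ≤ n) (j : ℕ) : waitCdf n d j ≤ waitCdf n d (j + 1) := by
  induction j generalizing d with
  | zero =>
    cases d with
    | zero => simp [waitCdf]
    | succ d =>
      rw [waitCdf]
      exact waitCdf_nonneg hd _
  | succ j ih =>
    cases d with
    | zero => simp [waitCdf]
    | succ d =>
      have h1 : (d : ℝ) / n ≤ 1 :=
        div_le_one_of_le₀ (by exact_mod_cast (by omega : d ≤ n)) (Nat.cast_nonneg n)
      have h2 : (0 : ℝ) ≤ (d : ℝ) / n := by positivity
      rw [waitCdf, waitCdf]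
      exact add_le_add (mul_le_mul_of_nonneg_left (ih (by omega)) (sub_nonneg.2 h1))
        (mul_le_mul_of_nonneg_left (ih hd) h2)

theorem waitCdf_le_one {d : ℕ} (hd : d ≤ n) (j : ℕ) : waitCdf n d j ≤ 1 := by
  induction j generalizing d with
  | zero => cases d <;> simp [waitCdf]
  | succ j ih =>
    cases d with
    | zero => simp [waitCdf]
    | succ d =>
      have h1 : (d : ℝ) / n ≤ 1 :=
        div_le_one_of_le₀ (by exact_mod_cast (by omega : d ≤ n)) (Nat.cast_nonneg n)
      have h2 : (0 : ℝ) ≤ (d : ℝ) / n := by positivity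
      rw [waitCdf]
      have h3 := mul_le_mul_of_nonneg_left (ih (by omega : d ≤ n)) (sub_nonneg.2 h1)
      have h4 := mul_le_mul_of_nonneg_left (ih hd) h2
      linarith

theorem one_sub_div_pos {d n : ℕ} (hd : d < n) : (0 : ℝ) < 1 - (d : ℝ) / n := by
  have hn : (0 : ℝ) < n := by exact_mod_cast (by omega : 0 < n)
  rw [sub_pos, div_lt_one hn]
  exact_mod_cast hd

theorem tendsto_waitCdf {d : ℕ} (hd : d ≤ n) :
    Tendsto (fun j => waitCdf n d j) atTop (nhds 1) := by
  induction d with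
  | zero => simp [waitCdf]
  | succ d ih =>
    have hmono : Monotone fun j => waitCdf n (d + 1) j :=
      monotone_nat_of_le_succ fun j => waitCdf_le_succ hd j
    have hbdd : BddAbove (Set.range fun j => waitCdf n (d + 1) j) :=
      ⟨1, by rintro _ ⟨j, rfl⟩; exact waitCdf_le_one hd j⟩
    have hlim := tendsto_atTop_ciSup hmono hbdd
    set L := ⨆ j, waitCdf n (d + 1) j
    have h1 : Tendsto (fun j => waitCdf n (d + 1) (j + 1)) atTop (nhds L) :=
      (tendsto_add_atTop_iff_nat (f := fun j => waitCdf n (d + 1) j) 1).2 hlim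
    have h2 : Tendsto (fun j => waitCdf n (d + 1) (j + 1)) atTop
        (nhds ((1 - (d : ℝ) / n) * 1 + (d : ℝ) / n * L)) := by
      simp only [waitCdf]
      exact ((ih (by omega)).const_mul _).add (hlim.const_mul _)
    have h3 := tendsto_nhds_unique h1 h2
    have h4 := one_sub_div_pos (by omega : d < n)
    have h5 : (1 - (d : ℝ) / n) * (L - 1) = 0 := by linarith
    have h6 : L = 1 := by
      rcases mul_eq_zero.1 h5 with h | h <;> linarith
    rwa [h6] at hlim

/-- The probability mass function of the waiting time for `d` distinct coupons. -/
noncomputable def waitPmf (n d : ℕ) : ℕ → ℝ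
  | 0 => waitCdf n d 0
  | j + 1 => waitCdf n d (j + 1) - waitCdf n d j

theorem waitPmf_nonneg {d : ℕ} (hd : d ≤ n) (j : ℕ) : 0 ≤ waitPmf n d j := by
  cases j with
  | zero => exact waitCdf_nonneg hd 0
  | succ j => exact sub_nonneg.2 (waitCdf_le_succ hd j)

theorem sum_range_waitPmf (n d j : ℕ) :
    ∑ l ∈ Finset.range (j + 1), waitPmf n d l = waitCdf n d j := by
  induction j with
  | zero => simp [waitPmf]
  | succ j ih => rw [Finset.sum_range_succ, ih, waitPmf]; ring

theorem hasSum_waitPmf {d : ℕ} (hd : d ≤ n) : HasSum (waitPmf n d) 1 := by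
  rw [hasSum_iff_tendsto_nat_of_nonneg (waitPmf_nonneg hd),
    ← tendsto_add_atTop_iff_nat (f := fun N => ∑ l ∈ Finset.range N, waitPmf n d l) 1]
  simp only [sum_range_waitPmf]
  exact tendsto_waitCdf hd

theorem waitPmf_succ_zero (n d : ℕ) : waitPmf n (d + 1) 0 = 0 := by
  simp [waitPmf, waitCdf]

theorem waitPmf_succ_succ (n d j : ℕ) : waitPmf n (d + 1) (j + 1) =
    (1 - (d : ℝ) / n) * waitPmf n d j + (d : ℝ) / n * waitPmf n (d + 1) j := by
  cases j with
  | zero => simp [waitPmf, waitCdf]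
  | succ j =>
    rw [waitPmf, waitPmf, waitPmf, waitCdf, waitCdf.eq_3 n d j]
    ring

/-- The characteristic function of the waiting time for `d` distinct coupons. -/
noncomputable def waitCharFun (n d : ℕ) (u : ℝ) : ℂ :=
  ∑' j : ℕ, (waitPmf n d j : ℂ) * Complex.exp (Complex.I * u) ^ j

theorem norm_exp_I_mul (u : ℝ) : ‖Complex.exp (Complex.I * u)‖ = 1 := by
  rw [mul_comm]
  exact Complex.norm_exp_ofReal_mul_I u

theorem summable_waitCharFun {d : ℕ} (hd : d ≤ n) (u : ℝ) :
    Summable fun j : ℕ => (waitPmf n d j : ℂ) * Complex.exp (Complex.I * u) ^ j := by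
  refine Summable.of_norm ?_
  simp only [norm_mul, norm_pow, norm_exp_I_mul, one_pow, mul_one, Complex.norm_real]
  exact (hasSum_waitPmf hd).summable.norm

theorem waitCharFun_zero (n : ℕ) (u : ℝ) : waitCharFun n 0 u = 1 := by
  unfold waitCharFun
  rw [tsum_eq_single 0]
  · simp [waitPmf, waitCdf]
  · intro j hj
    cases j with
    | zero => exact absurd rfl hj
    | succ j => simp [waitPmf, waitCdf]

theorem waitCharFun_succ {d : ℕ} (hd : d + 1 ≤ n) (u : ℝ) :
    (1 + (Complex.exp (-(Complex.I * u)) - 1) / (1 - (d : ℂ) / n)) * waitCharFun n (d + 1) u =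
      waitCharFun n d u := by
  have hp : (1 - (d : ℂ) / n) ≠ 0 := by
    have := Complex.ofReal_ne_zero.2 (one_sub_div_pos (by omega : d < n)).ne'
    push_cast at this
    exact this
  have hrec : waitCharFun n (d + 1) u = Complex.exp (Complex.I * u) *
      ((1 - (d : ℂ) / n) * waitCharFun n d u + (d : ℂ) / n * waitCharFun n (d + 1) u) := by
    have h1 := summable_waitCharFun (by omega : d ≤ n) u
    have h2 := summable_waitCharFun hd u
    conv_lhs => rw [waitCharFun, h2.tsum_eq_zero_add]
    rw [waitPmf_succ_zero]
    simp only [waitPmf_succ_succ, waitCharFun]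
    rw [← tsum_mul_left, ← tsum_mul_left, ← (h1.mul_left _).tsum_add (h2.mul_left _),
      ← tsum_mul_left]
    simp only [Complex.ofReal_zero, zero_mul, zero_add]
    congr 1
    funext j
    push_cast
    ring
  have hexp : Complex.exp (-(Complex.I * u)) * Complex.exp (Complex.I * u) = 1 := by
    rw [← Complex.exp_add]
    simp
  set Φ := waitCharFun n (d + 1) u
  set Ψ := waitCharFun n d u
  set e := Complex.exp (Complex.I * u)
  set e' := Complex.exp (-(Complex.I * u))
  have h3 : e' * Φ = (1 - (d : ℂ) / n) * Ψ + (d : ℂ) / n * Φ := by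
    calc e' * Φ = e' * (e * ((1 - (d : ℂ) / n) * Ψ + (d : ℂ) / n * Φ)) := by rw [← hrec]
      _ = (e' * e) * ((1 - (d : ℂ) / n) * Ψ + (d : ℂ) / n * Φ) := by ring
      _ = _ := by rw [hexp, one_mul]
  have h4 : (1 - (d : ℂ) / n) * ((1 + (e' - 1) / (1 - (d : ℂ) / n)) * Φ) =
      (1 - (d : ℂ) / n) * Ψ := by
    rw [← mul_assoc, mul_add, mul_div_cancel₀ _ hp]
    linear_combination h3
  exact mul_left_cancel₀ hp h4

theorem prod_mul_waitCharFun {d : ℕ} (hd : d ≤ n) (u : ℝ) :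
    (∏ i ∈ Finset.range d, (1 + (Complex.exp (-(Complex.I * u)) - 1) / (1 - (i : ℂ) / n))) *
      waitCharFun n d u = 1 := by
  induction d with
  | zero => simp [waitCharFun_zero]
  | succ d ih => rw [Finset.prod_range_succ, mul_assoc, waitCharFun_succ hd, ih (by omega)]

/-- The law of the waiting time for `d` distinct coupons. -/
noncomputable def waitLaw {d : ℕ} (hd : d ≤ n) : PMF ℕ :=
  ⟨fun j => ENNReal.ofReal (waitPmf n d j), by
    have h := (ENNReal.hasSum_coe (f := fun j => (waitPmf n d j).toNNReal) (r := 1)).2 (by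
      have h1 := hasSum_waitPmf hd
      rw [← NNReal.hasSum_coe]
      simpa [Real.coe_toNNReal _ (waitPmf_nonneg hd _)] using h1)
    simpa [ENNReal.ofReal] using h⟩

theorem waitLaw_Iic {d : ℕ} (hd : d ≤ n) (j : ℕ) :
    (waitLaw hd).toMeasure (Finset.range (j + 1)) = ENNReal.ofReal (waitCdf n d j) := by
  rw [PMF.toMeasure_apply_finset, ← sum_range_waitPmf,
    ENNReal.ofReal_sum_of_nonneg fun l _ => waitPmf_nonneg hd l]
  rfl

theorem charFun_map_waitLaw {d : ℕ} (hd : d ≤ n) (a b t : ℝ) :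
    charFun ((waitLaw hd).toMeasure.map fun j : ℕ => a - (j : ℝ) / b) t =
      Complex.exp (Complex.I * t * a) * waitCharFun n d (-t / b) := by
  have hmeas : Measurable fun j : ℕ => a - (j : ℝ) / b := measurable_of_countable _
  rw [charFun_apply_real, integral_map hmeas.aemeasurable (by fun_prop),
    PMF.integral_eq_tsum _ _ ?_, waitCharFun, ← tsum_mul_left]
  · congr 1
    funext j
    have h1 : ((waitLaw hd) j).toReal = waitPmf n d j := ENNReal.toReal_ofReal (waitPmf_nonneg hd j)
    rw [h1, ← Complex.exp_nat_mul, mul_left_comm, ← Complex.exp_add, Complex.real_smul]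
    congr 2
    push_cast
    ring
  · refine Integrable.of_bound (C := 1) (measurable_of_countable _).aestronglyMeasurable ?_
    refine ae_of_all _ fun j => ?_
    rw [← Complex.ofReal_mul, Complex.norm_exp_ofReal_mul_I]

end WaitingTime

/-- Pointwise convergence of the characteristic functions of the normalized waiting times
gives convergence of their distribution functions. -/
theorem tendsto_waitCdf_of_charFun {d j : ℕ → ℕ} (hd : ∀ n, d n ≤ n) {b : ℕ → ℝ}
    (hb : ∀ᶠ n in atTop, 0 < b n) (x : ℝ)
    (h : ∀ t : ℝ, Tendsto (fun n => Complex.exp (Complex.I * t * ((x + j n / b n : ℝ) : ℂ)) *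
      waitCharFun n (d n) (-t / b n)) atTop (nhds (Complex.exp (-t ^ 2 / 2)))) :
    Tendsto (fun n => waitCdf n (d n) (j n)) atTop
      (nhds ((ProbabilityTheory.gaussianReal 0 1).real (Set.Ici x))) := by
  let μ : ℕ → ProbabilityMeasure ℝ := fun n =>
    ⟨(waitLaw (hd n)).toMeasure.map fun l : ℕ => (x + j n / b n) - (l : ℝ) / b n,
      Measure.isProbabilityMeasure_map (measurable_of_countable _).aemeasurable⟩
  let μ₀ : ProbabilityMeasure ℝ := ⟨ProbabilityTheory.gaussianReal 0 1, inferInstance⟩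
  have hlim : Tendsto μ atTop (nhds μ₀) := by
    refine ProbabilityMeasure.tendsto_iff_tendsto_charFun.2 fun t => ?_
    have h1 : charFun (μ₀ : Measure ℝ) t = Complex.exp (-t ^ 2 / 2) := by
      change charFun (ProbabilityTheory.gaussianReal 0 1) t = _
      rw [ProbabilityTheory.charFun_gaussianReal]
      simp
      ring_nf
    rw [h1]
    refine (h t).congr fun n => ?_
    exact (charFun_map_waitLaw (hd n) _ _ _).symm
  have hfr : (μ₀ : Measure ℝ) (frontier (Set.Ici x)) = 0 := by
    rw [frontier_Ici]
    change ProbabilityTheory.gaussianReal 0 1 {x} = 0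
    have := ProbabilityTheory.nullSingletonClass_gaussianReal (μ := 0) (v := 1) one_ne_zero
    exact measure_singleton x
  have h2 := ProbabilityMeasure.tendsto_measure_of_null_frontier_of_tendsto' hlim hfr
  have h3 := (ENNReal.tendsto_toReal (measure_ne_top (μ₀ : Measure ℝ) (Set.Ici x))).comp h2
  refine h3.congr' ?_
  filter_upwards [hb] with n hbn
  change ((waitLaw (hd n)).toMeasure.map
    (fun l : ℕ => (x + j n / b n) - (l : ℝ) / b n) (Set.Ici x)).toReal = _
  rw [Measure.map_apply (measurable_of_countable _) measurableSet_Ici]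
  have h4 : (fun l : ℕ => (x + j n / b n) - (l : ℝ) / b n) ⁻¹' Set.Ici x =
      (Finset.range (j n + 1) : Set ℕ) := by
    ext l
    simp only [Set.mem_preimage, Set.mem_Ici, Finset.coe_range, Set.mem_Iio]
    have : x ≤ (x + j n / b n) - (l : ℝ) / b n ↔ (l : ℝ) / b n ≤ j n / b n := by
      constructor <;> intro _ <;> linarith
    rw [this, div_le_div_iff_of_pos_right hbn, Nat.cast_le, Nat.lt_succ_iff]
  rw [h4, waitLaw_Iic, ENNReal.toReal_ofReal (waitCdf_nonneg (hd n) _)]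

theorem gaussianReal_real_Ici (x : ℝ) :
    (ProbabilityTheory.gaussianReal 0 1).real (Set.Ici x) =
      1 - (Real.sqrt (2 * Real.pi))⁻¹ * ∫ t in Set.Iic x, Real.exp (-t ^ 2 / 2) := by
  have := ProbabilityTheory.nullSingletonClass_gaussianReal (μ := 0) (v := 1) one_ne_zero
  have h1 : (Set.Ici x) = (Set.Iio x)ᶜ := by simp
  rw [h1, probReal_compl_eq_one_sub measurableSet_Iio, measureReal_def, measure_congr Iio_ae_eq_Iic,
    ProbabilityTheory.gaussianReal_apply_eq_integral _ one_ne_zero,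
    ENNReal.toReal_ofReal (setIntegral_nonneg measurableSet_Iic fun t _ =>
      ProbabilityTheory.gaussianPDFReal_nonneg 0 1 t), ← integral_const_mul]
  simp [ProbabilityTheory.gaussianPDFReal]

section HarmonicSums

/-- The sum of `(1 - i/n)⁻ᵐ` over `i < d`. -/
noncomputable def invPowSum (n d m : ℕ) : ℝ :=
  ∑ i ∈ Finset.range d, ((1 - (i : ℝ) / n) ^ m)⁻¹

theorem one_sub_succ_div {n : ℕ} (d : ℕ) :
    1 - ((d + 1 : ℕ) : ℝ) / n = (1 - (d : ℝ) / n) - 1 / n := by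
  push_cast
  ring

theorem invPowSum_one_bounds {n d : ℕ} (hd : d < n) :
    0 ≤ -(n * Real.log (1 - (d : ℝ) / n)) - invPowSum n d 1 ∧
      -(n * Real.log (1 - (d : ℝ) / n)) - invPowSum n d 1 ≤ (1 - (d : ℝ) / n)⁻¹ - 1 := by
  induction d with
  | zero => simp [invPowSum]
  | succ d ih =>
    obtain ⟨h1, h2⟩ := ih (by omega)
    have hn : (0 : ℝ) < n := by exact_mod_cast (by omega : 0 < n)
    have ha := one_sub_div_pos (by omega : d < n)
    have hb := one_sub_div_pos hd
    have hs : invPowSum n (d + 1) 1 = invPowSum n d 1 + (1 - (d : ℝ) / n)⁻¹ := by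
      rw [invPowSum, Finset.sum_range_succ, pow_one, invPowSum]
    rw [hs]
    rw [one_sub_succ_div] at hb ⊢
    set a := 1 - (d : ℝ) / n
    set b := a - 1 / n with hbdef
    have hab : n * (a - b) = 1 := by
      rw [hbdef]
      field_simp
      ring
    have hlog : Real.log a - Real.log b = Real.log (a / b) := (Real.log_div ha.ne' hb.ne').symm
    have hup : Real.log (a / b) ≤ a / b - 1 := Real.log_le_sub_one_of_pos (div_pos ha hb)
    have hlo : 1 - (a / b)⁻¹ ≤ Real.log (a / b) := Real.one_sub_inv_le_log_of_pos (div_pos ha hb)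
    have e1 : n * (a / b - 1) = b⁻¹ := by
      rw [div_sub_one hb.ne', ← mul_div_assoc, hab, one_div]
    have e2 : n * (1 - (a / b)⁻¹) = a⁻¹ := by
      rw [inv_div, one_sub_div ha.ne', ← mul_div_assoc, hab, one_div]
    have hup' := mul_le_mul_of_nonneg_left hup hn.le
    have hlo' := mul_le_mul_of_nonneg_left hlo hn.le
    rw [e1, ← hlog] at hup'
    rw [e2, ← hlog] at hlo'
    constructor <;> linarith

theorem invPowSum_two_bounds {n d : ℕ} (hd : d < n) :
    0 ≤ n * ((1 - (d : ℝ) / n)⁻¹ - 1) - invPowSum n d 2 ∧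
      n * ((1 - (d : ℝ) / n)⁻¹ - 1) - invPowSum n d 2 ≤ ((1 - (d : ℝ) / n)⁻¹) ^ 2 - 1 := by
  induction d with
  | zero => simp [invPowSum]
  | succ d ih =>
    obtain ⟨h1, h2⟩ := ih (by omega)
    have hn : (0 : ℝ) < n := by exact_mod_cast (by omega : 0 < n)
    have ha := one_sub_div_pos (by omega : d < n)
    have hb := one_sub_div_pos hd
    have hs : invPowSum n (d + 1) 2 = invPowSum n d 2 + ((1 - (d : ℝ) / n)⁻¹) ^ 2 := by
      rw [invPowSum, Finset.sum_range_succ, inv_pow, invPowSum]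
    rw [hs]
    rw [one_sub_succ_div] at hb ⊢
    set a := 1 - (d : ℝ) / n
    set b := a - 1 / n with hbdef
    have hab : n * (a - b) = 1 := by
      rw [hbdef]
      field_simp
      ring
    have hba : b ≤ a := by
      have : (0 : ℝ) ≤ 1 / n := by positivity
      linarith
    have hinv : a⁻¹ ≤ b⁻¹ := inv_anti₀ hb hba
    have ha0 : 0 < a⁻¹ := inv_pos.2 ha
    have e : n * (b⁻¹ - a⁻¹) = a⁻¹ * b⁻¹ := by
      rw [inv_sub_inv hb.ne' ha.ne', ← mul_div_assoc, hab, one_div, mul_inv, mul_comm]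
    constructor <;> nlinarith

end HarmonicSums

section Asymptotics

variable {d : ℕ → ℕ} {τ y : ℝ}

theorem tendsto_sqrt_natCast : Tendsto (fun n : ℕ => √(n : ℝ)) atTop atTop :=
  Real.tendsto_sqrt_atTop.comp tendsto_natCast_atTop_atTop

theorem tendsto_one_sub_div
    (hdy : Tendsto (fun n : ℕ => ((d n : ℝ) - (1 - Real.exp (-τ)) * n) / √n) atTop (nhds y)) :
    Tendsto (fun n : ℕ => 1 - (d n : ℝ) / n) atTop (nhds (Real.exp (-τ))) := by
  have h1 := (hdy.mul tendsto_sqrt_natCast.inv_tendsto_atTop).const_sub (Real.exp (-τ))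
  rw [mul_zero, sub_zero] at h1
  refine h1.congr' ?_
  filter_upwards [eventually_gt_atTop 0] with n hn
  have hn' : (0 : ℝ) < n := by exact_mod_cast hn
  have hs : (n : ℝ) = √n * √n := (Real.mul_self_sqrt hn'.le).symm
  have hs0 : √(n : ℝ) ≠ 0 := (Real.sqrt_pos.2 hn').ne'
  rw [Pi.inv_apply, ← div_eq_mul_inv, div_div, ← hs]
  field_simp
  ring

theorem tendsto_sqrt_mul_log
    (hdy : Tendsto (fun n : ℕ => ((d n : ℝ) - (1 - Real.exp (-τ)) * n) / √n) atTop (nhds y)) :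
    Tendsto (fun n : ℕ => √n * (-Real.log (1 - (d n : ℝ) / n) - τ)) atTop
      (nhds (y * Real.exp τ)) := by
  have h1 := tendsto_one_sub_div hdy
  have h2 := (Real.hasDerivAt_log (Real.exp_pos (-τ)).ne').hasFDerivAt.hasFDerivWithinAt
    (s := Set.univ)
  have h3 := h2.lim (l := (atTop : Filter ℕ)) (c := fun n : ℕ => √(n : ℝ))
    (d := fun n : ℕ => (1 - (d n : ℝ) / n) - Real.exp (-τ)) (v := -y)
    (by simpa using h1.sub_const (Real.exp (-τ))) (by simp) (by
      refine hdy.neg.congr' ?_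
      filter_upwards [eventually_gt_atTop 0] with n hn
      have hn' : (0 : ℝ) < n := by exact_mod_cast hn
      have hs : √(n : ℝ) ^ 2 = n := Real.sq_sqrt hn'.le
      have hs0 : √(n : ℝ) ≠ 0 := (Real.sqrt_pos.2 hn').ne'
      rw [smul_eq_mul]
      field_simp
      rw [hs]
      ring)
  have h4 := h3.neg
  have h5 : -((ContinuousLinearMap.toSpanSingleton ℝ (Real.exp (-τ))⁻¹) (-y)) =
      y * Real.exp τ := by
    simp [Real.exp_neg]
  rw [h5] at h4
  refine h4.congr fun n => ?_
  rw [add_sub_cancel, Real.log_exp, smul_eq_mul]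
  ring

theorem tendsto_invPowSum_one_div
    (hdy : Tendsto (fun n : ℕ => ((d n : ℝ) - (1 - Real.exp (-τ)) * n) / √n) atTop (nhds y)) :
    Tendsto (fun n : ℕ => (-(n * Real.log (1 - (d n : ℝ) / n)) - invPowSum n (d n) 1) / √n)
      atTop (nhds 0) := by
  have h1 := tendsto_one_sub_div hdy
  have h2 := ((h1.inv₀ (Real.exp_pos _).ne').sub_const 1).mul
    tendsto_sqrt_natCast.inv_tendsto_atTop
  rw [mul_zero] at h2
  refine tendsto_of_tendsto_of_tendsto_of_le_of_le' tendsto_const_nhds h2 ?_ ?_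
  · filter_upwards [h1.eventually (lt_mem_nhds (Real.exp_pos (-τ))), eventually_gt_atTop 0]
      with n hn hn0
    have hn' : (0 : ℝ) < n := by exact_mod_cast hn0
    have hd : d n < n := by
      rw [sub_pos, div_lt_one hn'] at hn
      exact_mod_cast hn
    exact div_nonneg (invPowSum_one_bounds hd).1 (Real.sqrt_nonneg _)
  · filter_upwards [h1.eventually (lt_mem_nhds (Real.exp_pos (-τ))), eventually_gt_atTop 0]
      with n hn hn0
    have hn' : (0 : ℝ) < n := by exact_mod_cast hn0
    have hd : d n < n := by
      rw [sub_pos, div_lt_one hn'] at hn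
      exact_mod_cast hn
    rw [Pi.inv_apply, ← div_eq_mul_inv]
    exact div_le_div_of_nonneg_right (invPowSum_one_bounds hd).2 (Real.sqrt_nonneg _)

theorem tendsto_invPowSum_one_sub {j : ℕ → ℕ} {w : ℝ}
    (hdy : Tendsto (fun n : ℕ => ((d n : ℝ) - (1 - Real.exp (-τ)) * n) / √n) atTop (nhds y))
    (hjw : Tendsto (fun n : ℕ => ((j n : ℝ) - τ * n) / √n) atTop (nhds w)) :
    Tendsto (fun n : ℕ => (invPowSum n (d n) 1 - j n) / √n) atTop
      (nhds (y * Real.exp τ - w)) := by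
  have h := ((tendsto_sqrt_mul_log hdy).sub (tendsto_invPowSum_one_div hdy)).sub hjw
  rw [sub_zero] at h
  refine h.congr' ?_
  filter_upwards [eventually_gt_atTop 0] with n hn
  have hn' : (0 : ℝ) < n := by exact_mod_cast hn
  have hs : √(n : ℝ) ^ 2 = n := Real.sq_sqrt hn'.le
  have hs0 : √(n : ℝ) ≠ 0 := (Real.sqrt_pos.2 hn').ne'
  field_simp
  rw [hs]
  ring

theorem tendsto_invPowSum_one
    (hdy : Tendsto (fun n : ℕ => ((d n : ℝ) - (1 - Real.exp (-τ)) * n) / √n) atTop (nhds y)) :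
    Tendsto (fun n : ℕ => invPowSum n (d n) 1 / n) atTop (nhds τ) := by
  have h1 := ((tendsto_sqrt_mul_log hdy).sub (tendsto_invPowSum_one_div hdy)).mul
    tendsto_sqrt_natCast.inv_tendsto_atTop
  have h := h1.add_const τ
  rw [mul_zero, zero_add] at h
  refine h.congr' ?_
  filter_upwards [eventually_gt_atTop 0] with n hn
  have hn' : (0 : ℝ) < n := by exact_mod_cast hn
  have hs : √(n : ℝ) ^ 2 = n := Real.sq_sqrt hn'.le
  have hs0 : √(n : ℝ) ≠ 0 := (Real.sqrt_pos.2 hn').ne'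
  rw [Pi.inv_apply]
  field_simp
  rw [hs]
  ring

theorem tendsto_invPowSum_two
    (hdy : Tendsto (fun n : ℕ => ((d n : ℝ) - (1 - Real.exp (-τ)) * n) / √n) atTop (nhds y)) :
    Tendsto (fun n : ℕ => invPowSum n (d n) 2 / n) atTop (nhds (Real.exp τ - 1)) := by
  have h1 := tendsto_one_sub_div hdy
  have h2 := h1.inv₀ (Real.exp_pos _).ne'
  rw [← Real.exp_neg, neg_neg] at h2
  have h3 := ((h2.pow 2).sub_const 1).mul
    (tendsto_natCast_atTop_atTop (R := ℝ)).inv_tendsto_atTop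
  have h4 := (h2.sub_const 1).sub h3
  rw [mul_zero, sub_zero] at h4
  refine tendsto_of_tendsto_of_tendsto_of_le_of_le' h4 (h2.sub_const 1) ?_ ?_
  · filter_upwards [h1.eventually (lt_mem_nhds (Real.exp_pos (-τ))), eventually_gt_atTop 0]
      with n hn hn0
    have hn' : (0 : ℝ) < n := by exact_mod_cast hn0
    have hd : d n < n := by
      rw [sub_pos, div_lt_one hn'] at hn
      exact_mod_cast hn
    have h5 := (invPowSum_two_bounds hd).2
    rw [Pi.inv_apply, le_div_iff₀ hn', sub_mul, inv_mul_cancel_right₀ hn'.ne']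
    linarith
  · filter_upwards [h1.eventually (lt_mem_nhds (Real.exp_pos (-τ))), eventually_gt_atTop 0]
      with n hn hn0
    have hn' : (0 : ℝ) < n := by exact_mod_cast hn0
    have hd : d n < n := by
      rw [sub_pos, div_lt_one hn'] at hn
      exact_mod_cast hn
    have h5 := (invPowSum_two_bounds hd).1
    rw [div_le_iff₀ hn']
    linarith

/-- The imaginary number `-i c / √n`. -/
noncomputable def imagScale (c : ℝ) (n : ℕ) : ℂ := -(Complex.I * ((c / √n : ℝ) : ℂ))

theorem norm_imagScale (c : ℝ) (n : ℕ) : ‖imagScale c n‖ = |c| / √n := by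
  rw [imagScale, norm_neg, norm_mul, Complex.norm_I, one_mul, Complex.norm_real, Real.norm_eq_abs,
    abs_div, abs_of_nonneg (Real.sqrt_nonneg _)]

theorem tendsto_norm_imagScale (c : ℝ) : Tendsto (fun n => ‖imagScale c n‖) atTop (nhds 0) := by
  simp only [norm_imagScale]
  exact tendsto_sqrt_natCast.const_div_atTop |c|

theorem tendsto_imagScale (c : ℝ) : Tendsto (imagScale c) atTop (nhds 0) :=
  tendsto_zero_iff_norm_tendsto_zero.2 (tendsto_norm_imagScale c)

theorem sqrt_mul_imagScale (c : ℝ) {n : ℕ} (hn : 0 < n) :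
    ((√n : ℝ) : ℂ) * imagScale c n = -(Complex.I * c) := by
  have hs0 : ((√(n : ℝ) : ℝ) : ℂ) ≠ 0 :=
    Complex.ofReal_ne_zero.2 (Real.sqrt_pos.2 (by exact_mod_cast hn)).ne'
  rw [imagScale]
  push_cast
  field_simp

theorem tendsto_sqrt_mul_exp_sub_one (c : ℝ) :
    Tendsto (fun n : ℕ => ((√n : ℝ) : ℂ) * (Complex.exp (imagScale c n) - 1)) atTop
      (nhds (-(Complex.I * c))) := by
  have h2 := (Complex.hasDerivAt_exp 0).hasFDerivAt.hasFDerivWithinAt (s := Set.univ)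
  have h3 := h2.lim (l := (atTop : Filter ℕ)) (c := fun n : ℕ => ((√n : ℝ) : ℂ))
    (d := imagScale c) (v := -(Complex.I * c)) (tendsto_imagScale c) (by simp) (by
      refine tendsto_const_nhds.congr' ?_
      filter_upwards [eventually_gt_atTop 0] with n hn
      rw [smul_eq_mul, sqrt_mul_imagScale c hn])
  simpa using h3

theorem tendsto_mul_exp_sub_one_sub_self (c : ℝ) :
    Tendsto (fun n : ℕ => (n : ℂ) * (Complex.exp (imagScale c n) - 1 - imagScale c n)) atTop
      (nhds (-(c : ℂ) ^ 2 / 2)) := by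
  have h1 : Tendsto (fun n : ℕ => (n : ℂ) * (Complex.exp (imagScale c n) - 1 - imagScale c n
      - imagScale c n ^ 2 / 2)) atTop (nhds 0) := by
    refine squeeze_zero_norm' ?_ (tendsto_sqrt_natCast.const_div_atTop (|c| ^ 3))
    filter_upwards [eventually_gt_atTop 0,
      (tendsto_norm_imagScale c).eventually (ge_mem_nhds one_pos)] with n hn hz
    have h := Complex.exp_bound hz (n := 3) (by norm_num)
    simp only [Finset.sum_range_succ, Finset.sum_range_zero] at h
    norm_num [Nat.factorial] at h
    have hn' : (0 : ℝ) < n := by exact_mod_cast hn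
    have hs0 : 0 < √(n : ℝ) := Real.sqrt_pos.2 hn'
    have hs : √(n : ℝ) ^ 2 = n := Real.sq_sqrt hn'.le
    rw [norm_mul, Complex.norm_natCast]
    have h5 : ‖Complex.exp (imagScale c n) - 1 - imagScale c n - imagScale c n ^ 2 / 2‖ ≤
        ‖imagScale c n‖ ^ 3 := by
      calc _ = ‖Complex.exp (imagScale c n) - (1 + imagScale c n + imagScale c n ^ 2 / 2)‖ := by
            congr 1
            ring
        _ ≤ _ := h
        _ ≤ _ := by
          have : 0 ≤ ‖imagScale c n‖ ^ 3 := by positivity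
          linarith
    rw [norm_imagScale] at h5
    calc _ ≤ (n : ℝ) * (|c| / √n) ^ 3 := mul_le_mul_of_nonneg_left h5 hn'.le
      _ = |c| ^ 3 / √n := by
        nth_rewrite 1 [← hs]
        rw [div_pow]
        field_simp
  have h2 := h1.add_const (-(c : ℂ) ^ 2 / 2)
  rw [zero_add] at h2
  refine h2.congr' ?_
  filter_upwards [eventually_gt_atTop 0] with n hn
  have h3 := sqrt_mul_imagScale c hn
  have h4 : ((√n : ℝ) : ℂ) ^ 2 = n := by
    rw [← Complex.ofReal_pow, Real.sq_sqrt (Nat.cast_nonneg n), Complex.ofReal_natCast]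
  have h5 : (n : ℂ) * imagScale c n ^ 2 = -(c : ℂ) ^ 2 := by
    rw [← h4, ← mul_pow, h3, neg_sq, mul_pow, Complex.I_sq]
    ring
  linear_combination (-1 / 2 : ℂ) * h5

theorem norm_log_one_add_sub_le {w : ℂ} (hw : ‖w‖ ≤ 1 / 2) :
    ‖Complex.log (1 + w) - (w - w ^ 2 / 2)‖ ≤ ‖w‖ ^ 3 := by
  have h := Complex.norm_log_sub_logTaylor_le 2 (z := w) (by linarith)
  have h2 : Complex.logTaylor (2 + 1) w = w - w ^ 2 / 2 := by
    simp only [Complex.logTaylor, Finset.sum_range_succ, Finset.sum_range_zero]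
    norm_num
    ring
  rw [h2] at h
  refine h.trans ?_
  have h3 : (1 - ‖w‖)⁻¹ ≤ 2 := by
    rw [inv_le_comm₀ (by linarith) (by norm_num)]
    linarith
  have h4 : ‖w‖ ^ 3 * (1 - ‖w‖)⁻¹ ≤ ‖w‖ ^ 3 * 2 :=
    mul_le_mul_of_nonneg_left h3 (by positivity)
  have h5 : 0 ≤ ‖w‖ ^ 3 := by positivity
  norm_num at h4 ⊢
  linarith

theorem tendsto_sum_log
    (hdy : Tendsto (fun n : ℕ => ((d n : ℝ) - (1 - Real.exp (-τ)) * n) / √n) atTop (nhds y))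
    (c : ℝ) :
    (∀ᶠ n in atTop, ∀ i < d n,
      (1 + (Complex.exp (imagScale c n) - 1) / (1 - (i : ℂ) / n)) ≠ 0) ∧
    Tendsto (fun n : ℕ => (∑ i ∈ Finset.range (d n),
        Complex.log (1 + (Complex.exp (imagScale c n) - 1) / (1 - (i : ℂ) / n))) -
      ((Complex.exp (imagScale c n) - 1) * invPowSum n (d n) 1 -
        (Complex.exp (imagScale c n) - 1) ^ 2 / 2 * invPowSum n (d n) 2)) atTop (nhds 0) := by
  set β : ℕ → ℂ := fun n => Complex.exp (imagScale c n) - 1 with hβ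
  have hβ0 : Tendsto (fun n => ‖β n‖) atTop (nhds 0) := by
    have h := ((Complex.continuous_exp.tendsto 0).comp (tendsto_imagScale c)).sub_const 1
    rw [Complex.exp_zero, sub_self] at h
    exact tendsto_zero_iff_norm_tendsto_zero.1 h
  have h1 := tendsto_one_sub_div hdy
  set A := Real.exp (-τ) / 2 with hA
  have hA0 : 0 < A := by positivity
  have hAlt : A < Real.exp (-τ) := half_lt_self (Real.exp_pos _)
  have hw : ∀ᶠ n in atTop, d n ≤ n ∧
      ∀ i < d n, ‖β n / (1 - (i : ℂ) / n)‖ ≤ ‖β n‖ / A ∧ ‖β n‖ / A ≤ 1 / 2 := by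
    filter_upwards [h1.eventually (lt_mem_nhds hAlt), eventually_gt_atTop 0,
      hβ0.eventually (ge_mem_nhds (half_pos hA0))] with n hn hn0 hβn
    have hn' : (0 : ℝ) < n := by exact_mod_cast hn0
    constructor
    · have : (0 : ℝ) < 1 - (d n : ℝ) / n := hA0.trans hn
      rw [sub_pos, div_lt_one hn'] at this
      exact_mod_cast this.le
    · intro i hi
      have h2 : A ≤ 1 - (i : ℝ) / n := by
        have : (i : ℝ) / n ≤ (d n : ℝ) / n := by gcongr
        linarith
      have h3 : ‖(1 - (i : ℂ) / n)‖ = 1 - (i : ℝ) / n := by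
        rw [← abs_of_pos (hA0.trans_le h2), ← Real.norm_eq_abs, ← Complex.norm_real]
        push_cast
        rfl
      constructor
      · rw [norm_div, h3]
        gcongr
      · rw [div_le_iff₀ hA0]
        linarith
  constructor
  · filter_upwards [hw] with n hn i hi h0
    obtain ⟨h2, h3⟩ := hn.2 i hi
    have h4 : β n / (1 - (i : ℂ) / n) = -1 := by linear_combination h0
    rw [h4, norm_neg, norm_one] at h2
    linarith
  · have hlim : Tendsto (fun n : ℕ => ‖((√n : ℝ) : ℂ) * β n‖ ^ 3 / A ^ 3 * (√(n : ℝ))⁻¹)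
        atTop (nhds 0) := by
      have h := (((tendsto_sqrt_mul_exp_sub_one c).norm.pow 3).div_const (A ^ 3)).mul
        tendsto_sqrt_natCast.inv_tendsto_atTop
      rw [mul_zero] at h
      exact h
    refine squeeze_zero_norm' ?_ hlim
    filter_upwards [hw, eventually_gt_atTop 0] with n hn hn0
    have hn' : (0 : ℝ) < n := by exact_mod_cast hn0
    have hs0 : 0 < √(n : ℝ) := Real.sqrt_pos.2 hn'
    have hs : √(n : ℝ) ^ 2 = n := Real.sq_sqrt hn'.le
    have hsum : β n * invPowSum n (d n) 1 - β n ^ 2 / 2 * invPowSum n (d n) 2 =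
        ∑ i ∈ Finset.range (d n),
          (β n / (1 - (i : ℂ) / n) - (β n / (1 - (i : ℂ) / n)) ^ 2 / 2) := by
      rw [invPowSum, invPowSum]
      push_cast
      rw [Finset.mul_sum, Finset.mul_sum, ← Finset.sum_sub_distrib]
      refine Finset.sum_congr rfl fun i _ => ?_
      rw [pow_one, div_pow, div_eq_mul_inv, div_eq_mul_inv]
      ring
    change ‖_ - (β n * invPowSum n (d n) 1 - β n ^ 2 / 2 * invPowSum n (d n) 2)‖ ≤ _
    rw [hsum, ← Finset.sum_sub_distrib]
    calc _ ≤ ∑ i ∈ Finset.range (d n), (‖β n‖ / A) ^ 3 := by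
          refine (norm_sum_le _ _).trans (Finset.sum_le_sum fun i hi => ?_)
          obtain ⟨h2, h3⟩ := hn.2 i (Finset.mem_range.1 hi)
          exact (norm_log_one_add_sub_le (h2.trans h3)).trans
            (pow_le_pow_left₀ (norm_nonneg _) h2 3)
      _ = d n * (‖β n‖ / A) ^ 3 := by
          rw [Finset.sum_const, Finset.card_range, nsmul_eq_mul]
      _ ≤ n * (‖β n‖ / A) ^ 3 := by
          gcongr
          exact hn.1
      _ = _ := by
          rw [norm_mul, Complex.norm_real, Real.norm_eq_abs, abs_of_pos hs0, mul_pow, div_pow]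
          nth_rewrite 1 [← hs]
          field_simp

theorem tendsto_mul_waitCharFun {j : ℕ → ℕ} {w : ℝ} (hd : ∀ n, d n ≤ n)
    (hdy : Tendsto (fun n : ℕ => ((d n : ℝ) - (1 - Real.exp (-τ)) * n) / √n) atTop (nhds y))
    (hjw : Tendsto (fun n : ℕ => ((j n : ℝ) - τ * n) / √n) atTop (nhds w)) (c : ℝ) :
    Tendsto (fun n : ℕ => Complex.exp (imagScale c n * j n) * waitCharFun n (d n) (c / √n)) atTop
      (nhds (Complex.exp (Complex.I * c * ((y * Real.exp τ - w : ℝ) : ℂ) -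
        (c : ℂ) ^ 2 / 2 * ((Real.exp τ - 1 - τ : ℝ) : ℂ)))) := by
  obtain ⟨hne, hlog⟩ := tendsto_sum_log hdy c
  have t1 := (Complex.continuous_ofReal.tendsto _).comp (tendsto_invPowSum_one_sub hdy hjw)
  have t2 := (Complex.continuous_ofReal.tendsto _).comp (tendsto_invPowSum_one hdy)
  have t3 := (Complex.continuous_ofReal.tendsto _).comp (tendsto_invPowSum_two hdy)
  have key := (((t1.const_mul (Complex.I * c)).sub
    ((tendsto_mul_exp_sub_one_sub_self c).mul t2)).add
    ((((tendsto_sqrt_mul_exp_sub_one c).pow 2).div_const 2).mul t3)).sub hlog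
  have key' := (Complex.continuous_exp.tendsto _).comp key
  have hval : Complex.I * c * ((y * Real.exp τ - w : ℝ) : ℂ) - -(c : ℂ) ^ 2 / 2 * (τ : ℂ) +
      (-(Complex.I * c)) ^ 2 / 2 * ((Real.exp τ - 1 : ℝ) : ℂ) - 0 =
      Complex.I * c * ((y * Real.exp τ - w : ℝ) : ℂ) -
        (c : ℂ) ^ 2 / 2 * ((Real.exp τ - 1 - τ : ℝ) : ℂ) := by
    rw [neg_sq, mul_pow, Complex.I_sq]
    push_cast
    ring
  rw [hval] at key'
  refine key'.congr' ?_
  filter_upwards [hne, eventually_gt_atTop 0] with n hn hn0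
  have hn' : (n : ℂ) ≠ 0 := by exact_mod_cast hn0.ne'
  have hs0 : ((√(n : ℝ) : ℝ) : ℂ) ≠ 0 :=
    Complex.ofReal_ne_zero.2 (Real.sqrt_pos.2 (by exact_mod_cast hn0)).ne'
  have hs : ((√n : ℝ) : ℂ) ^ 2 = n := by
    rw [← Complex.ofReal_pow, Real.sq_sqrt (Nat.cast_nonneg n), Complex.ofReal_natCast]
  have hprod := prod_mul_waitCharFun (hd n) (c / √n)
  have hexp : ∏ i ∈ Finset.range (d n),
      (1 + (Complex.exp (imagScale c n) - 1) / (1 - (i : ℂ) / n)) =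
      Complex.exp (∑ i ∈ Finset.range (d n),
        Complex.log (1 + (Complex.exp (imagScale c n) - 1) / (1 - (i : ℂ) / n))) := by
    rw [Complex.exp_sum]
    refine Finset.prod_congr rfl fun i hi => ?_
    rw [Complex.exp_log (hn i (Finset.mem_range.1 hi))]
  change (∏ i ∈ Finset.range (d n),
    (1 + (Complex.exp (imagScale c n) - 1) / (1 - (i : ℂ) / n))) * _ = 1 at hprod
  rw [hexp] at hprod
  set Λ := ∑ i ∈ Finset.range (d n),
    Complex.log (1 + (Complex.exp (imagScale c n) - 1) / (1 - (i : ℂ) / n)) with hΛ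
  have hW : waitCharFun n (d n) (c / √n) = Complex.exp (-Λ) := by
    rw [Complex.exp_neg]
    exact eq_inv_of_mul_eq_one_right hprod
  rw [hW, ← Complex.exp_add, Function.comp_apply]
  congr 1
  simp only [Function.comp_apply]
  rw [← hΛ]
  clear_value Λ
  have hz := sqrt_mul_imagScale c hn0
  set z := imagScale c n
  clear_value z
  push_cast
  have hz' : Complex.I * c * (((invPowSum n (d n) 1 : ℂ) - j n) / ((√n : ℝ) : ℂ)) =
      -z * ((invPowSum n (d n) 1 : ℂ) - j n) := by
    field_simp
    linear_combination ((invPowSum n (d n) 1 : ℂ) - j n) * hz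
  rw [hz', mul_pow, hs]
  field_simp
  ring

/-- The central limit theorem for the coupon collector's waiting time. -/
theorem tendsto_waitCdf_normal {j : ℕ → ℕ} {w x : ℝ} (hτ : 0 < τ) (hd : ∀ n, d n ≤ n)
    (hdy : Tendsto (fun n : ℕ => ((d n : ℝ) - (1 - Real.exp (-τ)) * n) / √n) atTop (nhds y))
    (hjw : Tendsto (fun n : ℕ => ((j n : ℝ) - τ * n) / √n) atTop (nhds w))
    (hx : y * Real.exp τ - w = x * √(Real.exp τ - 1 - τ)) :
    Tendsto (fun n => waitCdf n (d n) (j n)) atTop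
      (nhds ((ProbabilityTheory.gaussianReal 0 1).real (Set.Ici x))) := by
  set v := Real.exp τ - 1 - τ with hv
  have hv0 : 0 < v := by
    have := Real.add_one_lt_exp hτ.ne'
    linarith
  have hsv : 0 < √v := Real.sqrt_pos.2 hv0
  refine tendsto_waitCdf_of_charFun hd (b := fun n => √n * √v) ?_ x fun t => ?_
  · filter_upwards [eventually_gt_atTop 0] with n hn
    exact mul_pos (Real.sqrt_pos.2 (by exact_mod_cast hn)) hsv
  · have h := (tendsto_mul_waitCharFun hd hdy hjw (-t / √v)).const_mul
      (Complex.exp (Complex.I * t * x))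
    have hsv' : ((√v : ℝ) : ℂ) ≠ 0 := Complex.ofReal_ne_zero.2 hsv.ne'
    have hsq : ((√v : ℝ) : ℂ) ^ 2 = (v : ℂ) := by
      rw [← Complex.ofReal_pow, Real.sq_sqrt hv0.le]
    rw [hx, ← hv, ← Complex.exp_add] at h
    have hval : Complex.I * t * x + (Complex.I * ((-t / √v : ℝ) : ℂ) * ((x * √v : ℝ) : ℂ) -
        ((-t / √v : ℝ) : ℂ) ^ 2 / 2 * (v : ℂ)) = -(t : ℂ) ^ 2 / 2 := by
      rw [← hsq]
      push_cast
      field_simp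
      ring
    rw [hval] at h
    refine h.congr fun n => ?_
    have hc : -t / √v / √n = -t / (√n * √v) := by rw [div_div, mul_comm]
    rw [← mul_assoc, ← Complex.exp_add, imagScale, hc]
    congr 2
    push_cast
    ring

end Asymptotics

section CentralLimit

theorem prob_not (n k : ℕ) [NeZero n] (P : (Fin n × Fin k → Fin n) → Prop) :
    prob n k (fun f => ¬P f) = 1 - prob n k P := by
  rw [eq_sub_iff_add_eq, prob_eq_avg, prob_eq_avg, ← avg_add]
  refine Eq.trans (congrArg avg (funext fun f => ?_))
    (avg_const (ι := Fin n × Fin k) (V := Fin n) 1)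
  by_cases h : P f <;> simp [h]

theorem tendsto_waitCdf_of_centred {d j : ℕ → ℕ} {τ y w x : ℝ} (hτ : 0 < τ)
    (hdy : Tendsto (fun n : ℕ => ((d n : ℝ) - (1 - Real.exp (-τ)) * n) / √n) atTop (nhds y))
    (hjw : Tendsto (fun n : ℕ => ((j n : ℝ) - τ * n) / √n) atTop (nhds w))
    (hx : y * Real.exp τ - w = x * √(Real.exp τ - 1 - τ)) :
    Tendsto (fun n => waitCdf n (d n) (j n)) atTop
      (nhds ((ProbabilityTheory.gaussianReal 0 1).real (Set.Ici x))) := by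
  have hle : ∀ᶠ n in atTop, min (d n) n = d n := by
    filter_upwards [(tendsto_one_sub_div hdy).eventually (lt_mem_nhds (Real.exp_pos _)),
      eventually_gt_atTop 0] with n h hn
    have hn' : (0 : ℝ) < n := by exact_mod_cast hn
    have h1 : (d n : ℝ) < n := (div_lt_one hn').1 (by linarith)
    exact min_eq_left (by exact_mod_cast h1.le)
  refine (tendsto_waitCdf_normal (d := fun n => min (d n) n) hτ (fun n => min_le_right _ _)
    (hdy.congr' ?_) hjw hx).congr' ?_
  · filter_upwards [hle] with n h
    rw [h]
  · filter_upwards [hle] with n h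
    rw [h]

theorem tendsto_floor_add_one_centred {α : ℝ} (hα : 0 < α) (β : ℝ) :
    (∀ᶠ n : ℕ in atTop, 0 ≤ α * n + β * √n) ∧
    Tendsto (fun n : ℕ => (((⌊α * n + β * √n⌋₊ + 1 : ℕ) : ℝ) - α * n) / √n) atTop (nhds β) := by
  have hpos : ∀ᶠ n : ℕ in atTop, 0 ≤ α * n + β * √n := by
    filter_upwards [tendsto_sqrt_natCast.eventually_ge_atTop (-β / α)] with n h
    have h1 : -β ≤ √n * α := (div_le_iff₀ hα).1 h
    have h2 : α * n + β * √n = √n * (√n * α + β) := by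
      have := Real.mul_self_sqrt (Nat.cast_nonneg (α := ℝ) n)
      linear_combination (-α) * this
    rw [h2]
    exact mul_nonneg (Real.sqrt_nonneg _) (by linarith)
  refine ⟨hpos, ?_⟩
  have h1 := (tendsto_sqrt_natCast.const_div_atTop 1).const_add β
  rw [add_zero] at h1
  refine tendsto_of_tendsto_of_tendsto_of_le_of_le' tendsto_const_nhds h1 ?_ ?_
  · filter_upwards [eventually_gt_atTop 0] with n hn
    rw [le_div_iff₀ (Real.sqrt_pos.2 (by exact_mod_cast hn))]
    have := Nat.lt_floor_add_one (α * n + β * √n)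
    push_cast
    linarith
  · filter_upwards [eventually_gt_atTop 0, hpos] with n hn h
    have hs : 0 < √(n : ℝ) := Real.sqrt_pos.2 (by exact_mod_cast hn)
    rw [div_le_iff₀ hs, add_mul, div_mul_cancel₀ _ hs.ne']
    have := Nat.floor_le h
    push_cast
    linarith

theorem tendsto_floor_sqrt_sqrt_div :
    Tendsto (fun n : ℕ => (⌊√√(n : ℝ)⌋₊ : ℝ) / √n) atTop (nhds 0) := by
  have h := (Real.tendsto_sqrt_atTop.comp tendsto_sqrt_natCast).const_div_atTop 1
  refine squeeze_zero (fun n => by positivity) (fun n => ?_) h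
  calc (⌊√√(n : ℝ)⌋₊ : ℝ) / √n ≤ √√n / √n := by
        gcongr
        exact Nat.floor_le (Real.sqrt_nonneg _)
    _ = 1 / √√n := Real.sqrt_div_self'

theorem exists_pow_le_mul {k : ℕ} {q : ℝ} (hq : 0 ≤ q) (hkq : k * q < 1) :
    ∃ z ρ : ℝ, 1 < z ∧ 0 ≤ ρ ∧ ρ < 1 ∧ (1 + q * (z - 1)) ^ k ≤ ρ * z := by
  have hd : HasDerivAt (fun z : ℝ => (1 + q * (z - 1)) ^ k - z) (k * q - 1) 1 := by
    have h := (((((hasDerivAt_id (1 : ℝ)).sub_const 1).const_mul q).const_add 1).pow k).sub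
      (hasDerivAt_id 1)
    have hv : (k : ℝ) * (1 + q * (id 1 - 1)) ^ (k - 1) * (q * 1) - 1 = k * q - 1 := by simp
    exact hv ▸ h
  have h1 := (hasDerivWithinAt_iff_tendsto_slope' (by simp)).1 (hd.hasDerivWithinAt (s := Set.Ioi 1))
  obtain ⟨z, hz, hz1⟩ := ((h1.eventually (gt_mem_nhds (sub_neg.2 hkq))).and
    self_mem_nhdsWithin).exists
  have hz1 : 1 < z := hz1
  have hz0 : 0 < z := by linarith
  rw [slope_def_field, div_lt_iff₀ (by linarith)] at hz
  simp only [sub_self, mul_zero, add_zero, one_pow, zero_mul, sub_zero, sub_neg] at hz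
  have h0 : 0 ≤ 1 + q * (z - 1) := by
    have := mul_nonneg hq (sub_nonneg.2 hz1.le)
    linarith
  exact ⟨z, (1 + q * (z - 1)) ^ k / z, hz1, by positivity, (div_lt_one hz0).2 hz,
    (div_mul_cancel₀ _ hz0.ne').ge⟩

theorem tendsto_prob_le_ncard_oneCore {k : ℕ} {s : ℕ → ℕ} {τ y x : ℝ} (hτ : 0 < τ)
    (hkτ : k * (1 - Real.exp (-τ)) = τ) (hk : k * Real.exp (-τ) < 1)
    (hs : Tendsto (fun n : ℕ => ((s n : ℝ) - (1 - Real.exp (-τ)) * n) / √n) atTop (nhds y))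
    (hx : y * (Real.exp τ - k) = x * √(Real.exp τ - 1 - τ)) :
    Tendsto (fun n => prob n k fun f => s n ≤ (oneCore f).ncard) atTop
      (nhds ((ProbabilityTheory.gaussianReal 0 1).real (Set.Ici x))) := by
  set a : ℕ → ℕ := fun n => ⌊√√(n : ℝ)⌋₊ with ha
  have ha_top : Tendsto a atTop atTop :=
    tendsto_nat_floor_atTop.comp (Real.tendsto_sqrt_atTop.comp tendsto_sqrt_natCast)
  have hj : Tendsto (fun n : ℕ => ((s n * k : ℕ) - τ * n) / √n) atTop (nhds (k * y)) := by
    refine (hs.const_mul (k : ℝ)).congr fun n => ?_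
    push_cast
    linear_combination (n / √n : ℝ) * -hkτ
  have hsn := tendsto_one_sub_div hs
  have has : ∀ᶠ n in atTop, a n ≤ s n := by
    have h1 : Tendsto (fun n : ℕ => 1 - (s n : ℝ) / n + a n / √n) atTop
        (nhds (Real.exp (-τ) + 0)) := hsn.add tendsto_floor_sqrt_sqrt_div
    rw [add_zero] at h1
    have h2 : Real.exp (-τ) < 1 := Real.exp_lt_one_iff.2 (by linarith)
    filter_upwards [h1.eventually (gt_mem_nhds h2), eventually_gt_atTop 0] with n h hn
    have hn1 : (1 : ℝ) ≤ n := by exact_mod_cast hn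
    have h3 : √(n : ℝ) ≤ n := Real.sqrt_le_self_iff.2 (Or.inr hn1)
    have h4 : (a n : ℝ) / n ≤ a n / √n := by
      gcongr
    have h5 : (a n : ℝ) / n < s n / n := by linarith
    have h6 := (div_lt_div_iff_of_pos_right (by linarith)).1 h5
    exact_mod_cast h6.le
  have hsa : Tendsto (fun n : ℕ => (((s n - a n : ℕ) : ℝ) - (1 - Real.exp (-τ)) * n) / √n) atTop
      (nhds y) := by
    have h := hs.sub tendsto_floor_sqrt_sqrt_div
    rw [sub_zero] at h
    refine h.congr' ?_
    filter_upwards [has] with n hn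
    rw [Nat.cast_sub hn]
    ring
  have hsa1 : Tendsto (fun n : ℕ => (((s n - a n + 1 : ℕ) : ℝ) - (1 - Real.exp (-τ)) * n) / √n)
      atTop (nhds y) := by
    have h := hsa.add (tendsto_sqrt_natCast.const_div_atTop 1)
    rw [add_zero] at h
    refine h.congr fun n => ?_
    push_cast
    ring
  have hx' : y * Real.exp τ - k * y = x * √(Real.exp τ - 1 - τ) := by rw [← hx]; ring
  have hlow := tendsto_waitCdf_of_centred hτ hs hj hx'
  have hup := tendsto_waitCdf_of_centred hτ hsa1 hj hx'
  obtain ⟨q, hq1, hq⟩ : ∃ q, Real.exp (-τ) < q ∧ k * q < 1 := by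
    have h : ContinuousAt (fun q : ℝ => k * q) (Real.exp (-τ)) := by fun_prop
    have h1 := (h.eventually (gt_mem_nhds hk)).filter_mono
      (nhdsWithin_le_nhds (s := Set.Ioi (Real.exp (-τ))))
    obtain ⟨q, h2, h3⟩ := (h1.and self_mem_nhdsWithin).exists
    exact ⟨q, h3, h2⟩
  obtain ⟨z, ρ, hz, hρ, hρ1, h⟩ := exists_pow_le_mul ((Real.exp_pos _).trans hq1).le hq
  have herr : Tendsto (fun n => (z ^ a n)⁻¹ * (1 - ρ)⁻¹) atTop (nhds 0) := by
    have h1 := ((tendsto_pow_atTop_atTop_of_one_lt hz).comp ha_top).inv_tendsto_atTop.mul_const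
      (1 - ρ)⁻¹
    rw [zero_mul] at h1
    exact h1
  have hup' := hup.add herr
  rw [add_zero] at hup'
  have hsle : ∀ᶠ n in atTop, 0 < n ∧ s n ≤ n := by
    filter_upwards [hsn.eventually (lt_mem_nhds (Real.exp_pos _)),
      eventually_gt_atTop 0] with n h hn
    have hn' : (0 : ℝ) < n := by exact_mod_cast hn
    have h1 : (s n : ℝ) < n := (div_lt_one hn').1 (by linarith)
    exact ⟨hn, by exact_mod_cast h1.le⟩
  refine tendsto_of_tendsto_of_tendsto_of_le_of_le' hlow hup' ?_ ?_
  · filter_upwards [hsle] with n ⟨hn, hsn⟩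
    have : NeZero n := ⟨hn.ne'⟩
    exact waitCdf_le_prob_oneCore hsn
  · filter_upwards [hsle, has, (tendsto_one_sub_div hsa).eventually (gt_mem_nhds hq1)]
      with n ⟨hn, hsn⟩ han hqn
    have : NeZero n := ⟨hn.ne'⟩
    have hn' : (0 : ℝ) < n := by exact_mod_cast hn
    refine prob_oneCore_le_waitCdf hsn han hz.le hρ hρ1 (le_trans ?_ h)
    have h1 : ((s n - a n : ℕ) : ℝ) / n ≤ 1 := by
      rw [div_le_one hn']
      exact_mod_cast (Nat.sub_le _ _).trans hsn
    have h2 : 0 ≤ (1 - ((s n - a n : ℕ) : ℝ) / n) * (z - 1) :=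
      mul_nonneg (by linarith) (by linarith)
    gcongr

end CentralLimit

/-- Central limit law for the size of the one-in-core of `𝒟_{n,k}`:
`(|𝒞_n| - ν_k n)/(σ_k √n)` converges in distribution to a standard normal,
where `τ_k` is the unique positive solution of `1 - τ/k - e^{-τ} = 0`,
`ν_k = τ_k/k` and `σ_k² = τ_k/(k e^{τ_k} (1 - k e^{-τ_k}))`. -/
theorem one_in_core_clt (k : ℕ) (hk : 2 ≤ k) (τ : ℝ) (hτpos : 0 < τ)
    (hτ : 1 - τ / k - Real.exp (-τ) = 0) (x : ℝ) :
    Filter.Tendsto (fun n : ℕ =>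
      prob n k (fun f =>
        (((oneCore f).ncard : ℝ) - (τ / k) * n) /
          (Real.sqrt (τ / (k * Real.exp τ * (1 - k * Real.exp (-τ)))) * Real.sqrt n) ≤ x))
      Filter.atTop
      (nhds ((Real.sqrt (2 * Real.pi))⁻¹ * ∫ t in Set.Iic x, Real.exp (-t ^ 2 / 2))) := by
  have hk0 : (0 : ℝ) < k := by
    have : 0 < k := by omega
    exact_mod_cast this
  have hν : τ / k = 1 - Real.exp (-τ) := by linarith
  have hkτ : k * (1 - Real.exp (-τ)) = τ := by
    rw [← hν]
    field_simp
  have hE : 0 < Real.exp τ := Real.exp_pos τ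
  have hEinv : Real.exp (-τ) * Real.exp τ = 1 := by rw [← Real.exp_add, neg_add_cancel, Real.exp_zero]
  have hkE : k * (Real.exp τ - 1) = τ * Real.exp τ := by
    linear_combination Real.exp τ * hkτ + k * hEinv
  have hv : 0 < Real.exp τ - 1 - τ := by
    have := Real.add_one_lt_exp hτpos.ne'
    linarith
  have hEk : 0 < Real.exp τ - k := by
    have h1 : (Real.exp τ - k) * (Real.exp τ - 1) = Real.exp τ * (Real.exp τ - 1 - τ) := by
      linear_combination -hkE
    have h2 : 0 < (Real.exp τ - k) * (Real.exp τ - 1) := by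
      rw [h1]
      positivity
    exact pos_of_mul_pos_left h2 (by linarith)
  have hsub : 0 < 1 - k * Real.exp (-τ) := by
    have h1 : 1 - k * Real.exp (-τ) = Real.exp (-τ) * (Real.exp τ - k) := by
      linear_combination -hEinv
    rw [h1]
    exact mul_pos (Real.exp_pos _) hEk
  set σ := √(τ / (k * Real.exp τ * (1 - k * Real.exp (-τ)))) with hσ
  have hσpos : 0 < σ := Real.sqrt_pos.2 (by positivity)
  have hσE : σ * (Real.exp τ - k) = √(Real.exp τ - 1 - τ) := by
    rw [← Real.sqrt_sq (mul_pos hσpos hEk).le, mul_pow, hσ, Real.sq_sqrt (by positivity)]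
    congr 1
    have h1 : k * Real.exp τ * (1 - k * Real.exp (-τ)) = k * (Real.exp τ - k) := by
      linear_combination -(k : ℝ) ^ 2 * hEinv
    rw [h1, div_mul_eq_mul_div, div_eq_iff (mul_pos hk0 hEk).ne']
    linear_combination (-(Real.exp τ - k)) * hkE
  obtain ⟨hpos, hs⟩ := tendsto_floor_add_one_centred (div_pos hτpos hk0) (x * σ)
  have hlim := tendsto_prob_le_ncard_oneCore hτpos hkτ (by linarith) (hν ▸ hs)
    (show x * σ * (Real.exp τ - k) = _ by rw [mul_assoc, hσE])
  have hlim' := hlim.const_sub 1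
  rw [gaussianReal_real_Ici, sub_sub_cancel] at hlim'
  refine hlim'.congr' ?_
  filter_upwards [eventually_gt_atTop 0, hpos] with n hn hn0
  have : NeZero n := ⟨hn.ne'⟩
  have hsn : 0 < √(n : ℝ) := Real.sqrt_pos.2 (by exact_mod_cast hn)
  rw [← prob_not]
  congr 1
  funext f
  rw [← hν, not_le, Nat.lt_succ_iff, Nat.le_floor_iff hn0, div_le_iff₀ (mul_pos hσpos hsn),
    sub_le_iff_le_add', ← mul_assoc]
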